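/- For a knot-like complex C with standard complex representative C(a_1,…,a_n), the integer P(C) = −2 Σ_{j>0} j φ_j(C) + Σ_{i=1}^n sgn(a_i) is equal to the U-grading gr_U of a U-tower generator of C, i.e. of a maximally U-graded U-nontorsion cycle in C/V. -/

import Mathlib

/-!
Common setup: the ring `R = 𝔽₂[U,V]/(UV = 0)`, bigraded free finitely generated chain
complexes over `R` ("pre-complexes"), knot-like complexes, local maps and local
equivalence, standard and semistandard complexes, short maps, the `Z^!` order,
the invariants `a_i`, `φ_j`, `P`, shift maps, tensor products, duals, and direct sums.
-/

set_option synthInstance.maxHeartbeats 1000000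
set_option maxHeartbeats 1000000

noncomputable section

/-- The polynomial ring `𝔽₂[U,V]`. -/
abbrev PolyUV : Type := MvPolynomial (Fin 2) (ZMod 2)

/-- The ideal `(U·V)`. -/
def IUV : Ideal PolyUV := Ideal.span {(MvPolynomial.X 0 * MvPolynomial.X 1 : PolyUV)}

/-- The ring `R = 𝔽₂[U,V]/(UV = 0)`. -/
abbrev RUV : Type := PolyUV ⧸ IUV

instance : CommRing RUV := Ideal.Quotient.commRing IUV

/-- The image of `U` in `R`. -/
def Uv : RUV := Ideal.Quotient.mk IUV (MvPolynomial.X 0)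

/-- The image of `V` in `R`. -/
def Vv : RUV := Ideal.Quotient.mk IUV (MvPolynomial.X 1)

/-- `r ∈ R` is homogeneous of bidegree `(p, q)` for the bigrading with
`gr(U) = (-2, 0)`, `gr(V) = (0, -2)`, `gr(1) = (0, 0)` (coefficients in `𝔽₂`). -/
def IsHomog (r : RUV) (p q : ℤ) : Prop :=
  r = 0 ∨ (∃ a : ℕ, r = Uv ^ a ∧ p = -(2 * (a : ℤ)) ∧ q = 0) ∨
    (∃ b : ℕ, r = Vv ^ b ∧ p = 0 ∧ q = -(2 * (b : ℤ)))

/-- A finitely generated free bigraded module over `R` with a distinguished basis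
indexed by `Fin n`, together with a bigrading `gr` on the basis and a matrix `dm`
recording a prospective differential: `dm i j` is the coefficient of the `j`-th basis
vector in the differential of the `i`-th basis vector. -/
structure PreCx where
  n : ℕ
  gr : Fin n → ℤ × ℤ
  dm : Fin n → Fin n → RUV

/-- The underlying free `R`-module of a pre-complex. -/
abbrev Msub (C : PreCx) : Type := Fin C.n →₀ RUV

/-- The differential of a pre-complex, as an `R`-linear map. -/
def dmap (C : PreCx) : Msub C →ₗ[RUV] Msub C :=
  Finsupp.linearCombination RUV fun i => ∑ j, Finsupp.single j (C.dm i j)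

/-- The submodule `U·C ⊆ C`; `C/U` is the quotient by this submodule. -/
def uSub (C : PreCx) : Submodule RUV (Msub C) :=
  LinearMap.range (LinearMap.lsmul RUV (Msub C) Uv)

/-- The submodule `V·C ⊆ C`; `C/V` is the quotient by this submodule. -/
def vSub (C : PreCx) : Submodule RUV (Msub C) :=
  LinearMap.range (LinearMap.lsmul RUV (Msub C) Vv)

/-- Chains which die in the homology of `C/U`: the preimage in `C` of the boundaries of
the induced differential on `C/U`. -/
def bdryU (C : PreCx) : Submodule RUV (Msub C) := uSub C ⊔ LinearMap.range (dmap C)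

/-- Chains which die in the homology of `C/V`. -/
def bdryV (C : PreCx) : Submodule RUV (Msub C) := vSub C ⊔ LinearMap.range (dmap C)

/-- A chain `x ∈ C` is homogeneous of bidegree `(p, q)`. -/
def ChainHomog (C : PreCx) (x : Msub C) (p q : ℤ) : Prop :=
  ∀ j, IsHomog (x j) (p - (C.gr j).1) (q - (C.gr j).2)

/-- `x` is a `V`-tower class generator: its class in `H_*(C/U)` is a `V`-nontorsion cycle
whose image generates `H_*(C/U)/(V-torsion)` (equivalently, it is maximally `V`-graded
among `V`-nontorsion classes). -/
def IsVTowerGen (C : PreCx) (x : Msub C) : Prop :=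
  dmap C x ∈ uSub C ∧ (∀ k : ℕ, Vv ^ k • x ∉ bdryU C) ∧
    ∀ z : Msub C, dmap C z ∈ uSub C →
      ∃ (r : RUV) (k : ℕ), Vv ^ k • (z - r • x) ∈ bdryU C

/-- `x` is a `U`-tower class generator: its class in `H_*(C/V)` is a `U`-nontorsion cycle
whose image generates `H_*(C/V)/(U-torsion)`. -/
def IsUTowerGen (C : PreCx) (x : Msub C) : Prop :=
  dmap C x ∈ vSub C ∧ (∀ k : ℕ, Uv ^ k • x ∉ bdryV C) ∧
    ∀ z : Msub C, dmap C z ∈ vSub C →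
      ∃ (r : RUV) (k : ℕ), Uv ^ k • (z - r • x) ∈ bdryV C

/-- `C` is a chain complex over `R` whose differential has degree `(-1, -1)`. -/
def IsCplx (C : PreCx) : Prop :=
  (∀ x, dmap C (dmap C x) = 0) ∧
    ∀ i j, IsHomog (C.dm i j) ((C.gr i).1 - 1 - (C.gr j).1) ((C.gr i).2 - 1 - (C.gr j).2)

/-- A knot-like complex: a free, finitely generated, bigraded chain complex over `R`
whose differential has degree `(-1,-1)`, such that `H_*(C/U)/(V`-torsion`) ≅ 𝔽₂[V]` with
all `V`-nontorsion elements of `H_*(C/U)` in `U`-grading `0`, and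
`H_*(C/V)/(U`-torsion`) ≅ 𝔽₂[U]` with all `U`-nontorsion elements of `H_*(C/V)` in
`V`-grading `0`. -/
structure IsKnotLike (C : PreCx) : Prop where
  dsq : ∀ x, dmap C (dmap C x) = 0
  dhomog : ∀ i j, IsHomog (C.dm i j)
    ((C.gr i).1 - 1 - (C.gr j).1) ((C.gr i).2 - 1 - (C.gr j).2)
  vTowerExists : ∃ x, IsVTowerGen C x
  vTowerGr : ∀ x p q, ChainHomog C x p q → dmap C x ∈ uSub C →
    (∀ k : ℕ, Vv ^ k • x ∉ bdryU C) → p = 0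
  uTowerExists : ∃ x, IsUTowerGen C x
  uTowerGr : ∀ x p q, ChainHomog C x p q → dmap C x ∈ vSub C →
    (∀ k : ℕ, Uv ^ k • x ∉ bdryV C) → q = 0

/-- A module map `f : C₁ → C₂` is homogeneous of bidegree `(s, t)`. -/
def MapHomogShift (C₁ C₂ : PreCx) (f : Msub C₁ →ₗ[RUV] Msub C₂) (s t : ℤ) : Prop :=
  ∀ i j, IsHomog (f (Finsupp.single i 1) j)
    ((C₁.gr i).1 + s - (C₂.gr j).1) ((C₁.gr i).2 + t - (C₂.gr j).2)

/-- A local map `f : C₁ → C₂`: an absolutely `U`-graded, relatively `V`-graded,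
`R`-equivariant chain map inducing an isomorphism on `H_*(·/U)/(V-torsion)`
(equivalently, taking `V`-tower generators to `V`-tower generators). -/
structure IsLocalMap (C₁ C₂ : PreCx) (f : Msub C₁ →ₗ[RUV] Msub C₂) : Prop where
  chain : ∀ x, f (dmap C₁ x) = dmap C₂ (f x)
  graded : ∃ s : ℤ, MapHomogShift C₁ C₂ f 0 s
  towers : ∀ x, IsVTowerGen C₁ x → IsVTowerGen C₂ (f x)

/-- `C₁ ≤ C₂`: there exists a local map `C₁ → C₂`. -/
def LocalLE (C₁ C₂ : PreCx) : Prop := ∃ f, IsLocalMap C₁ C₂ f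

/-- Local equivalence of complexes: local maps in both directions. -/
def LocalEquiv (C₁ C₂ : PreCx) : Prop := LocalLE C₁ C₂ ∧ LocalLE C₂ C₁

/-- `C` is reduced: `∂ ≡ 0 mod (U, V)`. -/
def Reduced (C : PreCx) : Prop := ∀ i j, C.dm i j ∈ Ideal.span ({Uv, Vv} : Set RUV)

/-! ### Standard complexes -/

/-- The shift in bigrading from `x_k` to `x_{k+1}` in a standard complex, where the
parameter joining them is `b` (`k` is the 0-based index of the parameter, so the
parameter is a `U`-power arrow if `k` is even and a `V`-power arrow if `k` is odd). -/
def stepShift (k : ℕ) (b : ℤ) : ℤ × ℤ :=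
  if k % 2 = 0 then
    if b < 0 then (2 * (b.natAbs : ℤ) - 1, -1) else (1 - 2 * (b.natAbs : ℤ), 1)
  else
    if b < 0 then (-1, 2 * (b.natAbs : ℤ) - 1) else (1, 1 - 2 * (b.natAbs : ℤ))

/-- Bigrading of `x_i` relative to `x_0` in the standard complex with parameters `L`. -/
def grRel (L : List ℤ) (i : ℕ) : ℤ × ℤ :=
  ∑ k ∈ Finset.range i, stepShift k (L.getD k 0)

/-- The bigrading of the standard complex of parameters `L`, normalized so that
`gr_U(x_0) = 0` and `gr_V(x_n) = 0`. -/
def stdGr (L : List ℤ) (i : Fin (L.length + 1)) : ℤ × ℤ :=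
  ((grRel L (i : ℕ)).1, (grRel L (i : ℕ)).2 - (grRel L L.length).2)

/-- The differential matrix of the standard complex of parameters `L = (b_1, …, b_n)`:
for `i` odd (1-based), `∂_U x_{i-1} = U^{|b_i|} x_i` if `b_i < 0` and
`∂_U x_i = U^{b_i} x_{i-1}` if `b_i > 0`; for `i` even the same with `V` in place of `U`;
all other differentials vanish. -/
def stdDm (L : List ℤ) (i j : Fin (L.length + 1)) : RUV :=
  if (j : ℕ) = (i : ℕ) + 1 ∧ L.getD (i : ℕ) 0 < 0 then
    (if (i : ℕ) % 2 = 0 then Uv else Vv) ^ (L.getD (i : ℕ) 0).natAbs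
  else if (i : ℕ) = (j : ℕ) + 1 ∧ 0 < L.getD (j : ℕ) 0 then
    (if (j : ℕ) % 2 = 0 then Uv else Vv) ^ (L.getD (j : ℕ) 0).natAbs
  else 0

/-- The standard complex `C(b_1, …, b_n)` of a list of parameters `L = (b_1, …, b_n)`,
with generators `x_0, …, x_n`.  (For `L = []` this is the trivial complex `R`.) -/
def StdCx (L : List ℤ) : PreCx := ⟨L.length + 1, stdGr L, stdDm L⟩

/-- `L` is a valid parameter sequence for a standard complex: all entries are nonzero
and the length is even (possibly zero). -/
def IsStdSeq (L : List ℤ) : Prop := (∀ b ∈ L, b ≠ 0) ∧ Even L.length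

/-- The trivial standard complex `C(0) = R`. -/
def trivCx : PreCx := StdCx []

/-- The bigrading of the semistandard complex `C'(b_1, …, b_n)` (`n` odd), inherited from
the ambient standard complex `C(b_1, …, b_n, 1)`. -/
def semiGr (L : List ℤ) (i : Fin (L.length + 1)) : ℤ × ℤ :=
  ((grRel L (i : ℕ)).1, (grRel L (i : ℕ)).2 - (grRel L L.length).2 + 1)

/-- The semistandard complex `C'(b_1, …, b_n)` (`n` odd): the subcomplex of
`C(b_1, …, b_n, 1)` generated by `x_0, …, x_n`. -/
def SemiStdCx (L : List ℤ) : PreCx := ⟨L.length + 1, semiGr L, stdDm L⟩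

/-! ### Tensor products, duals, direct sums -/

/-- The tensor product (over `R`) of two pre-complexes, with basis `x_i ⊗ y_j` and
differential `∂(x ⊗ y) = ∂x ⊗ y + x ⊗ ∂y` (signs are irrelevant in characteristic 2). -/
def tensorCx (C₁ C₂ : PreCx) : PreCx where
  n := C₁.n * C₂.n
  gr := fun p => C₁.gr (finProdFinEquiv.symm p).1 + C₂.gr (finProdFinEquiv.symm p).2
  dm := fun p q =>
    (if (finProdFinEquiv.symm p).2 = (finProdFinEquiv.symm q).2 then
      C₁.dm (finProdFinEquiv.symm p).1 (finProdFinEquiv.symm q).1 else 0) +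
    (if (finProdFinEquiv.symm p).1 = (finProdFinEquiv.symm q).1 then
      C₂.dm (finProdFinEquiv.symm p).2 (finProdFinEquiv.symm q).2 else 0)

/-- The dual complex `C^∨ = Hom_R(C, R)`, described on the dual basis: the gradings are
negated and the differential matrix is transposed. -/
def dualCx (C : PreCx) : PreCx := ⟨C.n, fun i => -C.gr i, fun i j => C.dm j i⟩

/-- The direct sum of two pre-complexes. -/
def sumCx (C₁ C₂ : PreCx) : PreCx where
  n := C₁.n + C₂.n
  gr := fun p => Sum.elim C₁.gr C₂.gr (finSumFinEquiv.symm p)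
  dm := fun p q =>
    match finSumFinEquiv.symm p, finSumFinEquiv.symm q with
    | Sum.inl i, Sum.inl k => C₁.dm i k
    | Sum.inr j, Sum.inr l => C₂.dm j l
    | _, _ => 0

/-- A homotopy equivalence of bigraded chain complexes over `R`: chain maps `f, g`
preserving the bigrading, with `g ∘ f ≃ id` and `f ∘ g ≃ id` via `R`-equivariant
homotopies of bidegree `(1, 1)`. -/
def HomotopyEquivCx (C₁ C₂ : PreCx) : Prop :=
  ∃ (f : Msub C₁ →ₗ[RUV] Msub C₂) (g : Msub C₂ →ₗ[RUV] Msub C₁)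
    (H : Msub C₁ →ₗ[RUV] Msub C₁) (K : Msub C₂ →ₗ[RUV] Msub C₂),
    (∀ x, f (dmap C₁ x) = dmap C₂ (f x)) ∧
    (∀ y, g (dmap C₂ y) = dmap C₁ (g y)) ∧
    MapHomogShift C₁ C₂ f 0 0 ∧ MapHomogShift C₂ C₁ g 0 0 ∧
    MapHomogShift C₁ C₁ H 1 1 ∧ MapHomogShift C₂ C₂ K 1 1 ∧
    (∀ x, g (f x) - x = dmap C₁ (H x) + H (dmap C₁ x)) ∧
    (∀ y, f (g y) - y = dmap C₂ (K y) + K (dmap C₂ y))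

/-- An isomorphism of bigraded chain complexes over `R`. -/
def IsBigradedChainIso (C₁ C₂ : PreCx) (f : Msub C₁ →ₗ[RUV] Msub C₂) : Prop :=
  Function.Bijective f ∧ (∀ x, f (dmap C₁ x) = dmap C₂ (f x)) ∧ MapHomogShift C₁ C₂ f 0 0

/-! ### Short maps -/

/-- A short map `f : C(b_1, …, b_n) ⇝ C`: an absolutely `U`-graded, relatively
`V`-graded `R`-module map which is a chain map at `x_1, …, x_{n-1}` and commutes with
the `V`-part of the differential at `x_n` (for reduced `C`, the failure
`∂ f(x_n) - f(∂_V x_n)` is exactly `∂_U f(x_n) ∈ U·C`). -/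
def IsShortMap (L : List ℤ) (C : PreCx) (f : Msub (StdCx L) →ₗ[RUV] Msub C) : Prop :=
  (∃ s : ℤ, MapHomogShift (StdCx L) C f 0 s) ∧
  (∀ i : Fin (L.length + 1), 1 ≤ (i : ℕ) → (i : ℕ) + 1 ≤ L.length →
    f (dmap (StdCx L) (Finsupp.single i 1)) = dmap C (f (Finsupp.single i 1))) ∧
  dmap C (f (Finsupp.single (Fin.last L.length) 1)) -
    f (dmap (StdCx L) (Finsupp.single (Fin.last L.length) 1)) ∈ uSub C

/-- A short local map: a short map sending the `V`-tower generator `x_0` to a `V`-tower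
generator (hence inducing an isomorphism on `H_*(·/U)/(V-torsion)`). -/
def IsShortLocalMap (L : List ℤ) (C : PreCx) (f : Msub (StdCx L) →ₗ[RUV] Msub C) : Prop :=
  IsShortMap L C f ∧ IsVTowerGen C (f (Finsupp.single (0 : Fin (L.length + 1)) 1))

/-- A local map from the semistandard complex `C'(b_1, …, b_n)` to a knot-like complex:
a grading-preserving `R`-equivariant chain map under which the class of `x_0`
generates `H_*(C/U)/(V-torsion)`. -/
def IsSemiLocalMap (L : List ℤ) (C : PreCx) (f : Msub (SemiStdCx L) →ₗ[RUV] Msub C) : Prop :=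
  (∀ x, f (dmap (SemiStdCx L) x) = dmap C (f x)) ∧
  MapHomogShift (SemiStdCx L) C f 0 0 ∧
  IsVTowerGen C (f (Finsupp.single (0 : Fin (L.length + 1)) 1))

/-! ### The order `Z^!` and the numerical invariants -/

/-- The embedding of `Z^!` into `ℚ` realizing the order
`-1 <^! -2 <^! ⋯ <^! 0 <^! ⋯ <^! 2 <^! 1`: send `0 ↦ 0` and `a ↦ 1/a` otherwise. -/
def qval (a : ℤ) : ℚ := if a = 0 then 0 else 1 / (a : ℚ)

/-- The order `≤^!` on `Z^!`. -/
def bangLE (a b : ℤ) : Prop := qval a ≤ qval b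

/-- Pad a finite sequence with trailing zeros. -/
def seqPad (L : List ℤ) (i : ℕ) : ℤ := L.getD i 0

/-- The lexicographic order on finite integer sequences induced by `≤^!`, padding the
shorter sequence with trailing zeros. -/
def bangLexLE (L₁ L₂ : List ℤ) : Prop :=
  (∀ i, seqPad L₁ i = seqPad L₂ i) ∨
    ∃ k, (∀ i < k, seqPad L₁ i = seqPad L₂ i) ∧ qval (seqPad L₁ k) < qval (seqPad L₂ k)

/-- `m` is an upper bound for `S ⊆ Z^!` with respect to `≤^!`. -/
def IsBangUB (S : Set ℤ) (m : ℤ) : Prop := ∀ b ∈ S, qval b ≤ qval m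

/-- `m = sup^! S`, the least upper bound of `S ⊆ Z^!` with respect to `≤^!`. -/
def IsBangLUB (S : Set ℤ) (m : ℤ) : Prop :=
  IsBangUB S m ∧ ∀ m' : ℤ, IsBangUB S m' → qval m ≤ qval m'

/-- Candidate set for the next invariant: given the already-constructed prefix `P`,
those nonzero `b` such that some standard complex `C(P, b, rest) ≤ C`. -/
def candSet (C : PreCx) (P : List ℤ) : Set ℤ :=
  {b | b ≠ 0 ∧ ∃ rest : List ℤ, IsStdSeq (P ++ b :: rest) ∧ LocalLE (StdCx (P ++ b :: rest)) C}

/-- `a` is the sequence of numerical invariants `a_i(C)` (indexed from `0`):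
once a term vanishes all later terms vanish, and otherwise each term is
`sup^!` of the corresponding candidate set. -/
def InvSeq (C : PreCx) (a : ℕ → ℤ) : Prop :=
  ∀ k : ℕ,
    ((∃ i < k, a i = 0) → a k = 0) ∧
    ((∀ i < k, a i ≠ 0) → IsBangLUB (candSet C ((List.range k).map a)) (a k))

/-- The first `n` terms of `a`, with the (all-zero) tail deleted. -/
def truncSeq (a : ℕ → ℤ) (n : ℕ) : List ℤ :=
  ((List.range n).map a).takeWhile (fun b => b != 0)

/-! ### The homomorphisms `φ_j`, `P` and the shifts `sh_m` -/

/-- `φ_j` of a standard complex `C(a_1, …, a_n)`: the signed count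
`#{i odd : a_i = j} − #{i odd : a_i = −j}` (with 1-based odd `i`). -/
def phi (j : ℕ) (L : List ℤ) : ℤ :=
  ∑ i ∈ Finset.range L.length,
    if i % 2 = 0 then
      (if L.getD i 0 = (j : ℤ) then 1 else 0) - (if L.getD i 0 = -(j : ℤ) then 1 else 0)
    else 0

/-- The shift `sh_m` on parameter sequences: entries of absolute value `≥ m` are pushed
one further from zero; entries of absolute value `< m` are fixed. -/
def shSeq (m : ℕ) (L : List ℤ) : List ℤ :=
  L.map fun a => if (m : ℤ) ≤ a then a + 1 else if a ≤ -(m : ℤ) then a - 1 else a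

/-- `P(C) = -2 ∑_{j>0} j φ_j(C) + ∑_i sgn a_i`, computed from the parameter sequence of
the standard representative (the sum over `j` is finite since `φ_j` vanishes for
`j` larger than any `|a_i|`). -/
def Pval (L : List ℤ) : ℤ :=
  -2 * (∑ j ∈ Finset.range ((L.map Int.natAbs).sum + 1), (j : ℤ) * phi j L) +
    (L.map Int.sign).sum

end

noncomputable section

open Polynomial in
/-- Evaluation of `r ∈ R` at `U = u`, `V = v`, for polynomials `u`, `v` with `u * v = 0`. -/
def evalUV (u v : (ZMod 2)[X]) (huv : u * v = 0) : RUV →+* (ZMod 2)[X] :=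
  Ideal.Quotient.lift IUV (MvPolynomial.eval₂Hom Polynomial.C ![u, v]) (by
    intro a ha
    have hle : IUV ≤ RingHom.ker (MvPolynomial.eval₂Hom Polynomial.C ![u, v]) := by
      rw [IUV, Ideal.span_le]
      simp [RingHom.mem_ker, huv]
    exact RingHom.mem_ker.1 (hle ha))

open Polynomial in
/-- The quotient map `R → R/U = 𝔽₂[V]`. -/
def modU : RUV →+* (ZMod 2)[X] := evalUV 0 Polynomial.X (zero_mul _)

open Polynomial in
/-- The quotient map `R → R/V = 𝔽₂[U]`. -/
def modV : RUV →+* (ZMod 2)[X] := evalUV Polynomial.X 0 (mul_zero _)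

theorem evalUV_Uv (u v : Polynomial (ZMod 2)) (huv : u * v = 0) : evalUV u v huv Uv = u := by
  rw [evalUV, Uv, Ideal.Quotient.lift_mk]
  simp

theorem evalUV_Vv (u v : Polynomial (ZMod 2)) (huv : u * v = 0) : evalUV u v huv Vv = v := by
  rw [evalUV, Vv, Ideal.Quotient.lift_mk]
  simp

@[simp] theorem modU_Uv : modU Uv = 0 := evalUV_Uv _ _ _
@[simp] theorem modU_Vv : modU Vv = Polynomial.X := evalUV_Vv _ _ _
@[simp] theorem modV_Uv : modV Uv = Polynomial.X := evalUV_Uv _ _ _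
@[simp] theorem modV_Vv : modV Vv = 0 := evalUV_Vv _ _ _

theorem Uv_mul_Vv : Uv * Vv = 0 := by
  rw [Uv, Vv, ← map_mul, Ideal.Quotient.eq_zero_iff_mem]
  exact Ideal.subset_span rfl

/-- Ring homomorphisms out of `R` are determined by the images of `U` and `V`. -/
theorem RUV.hom_ext {S : Type*} [CommRing S] {f g : RUV →+* S}
    (hU : f Uv = g Uv) (hV : f Vv = g Vv) : f = g := by
  apply Ideal.Quotient.ringHom_ext
  apply MvPolynomial.ringHom_ext'
  · exact RingHom.ext_zmod _ _
  · intro i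
    fin_cases i
    · exact hU
    · exact hV

theorem constantCoeff_modU_eq (r : RUV) :
    (modU r).coeff 0 = (modV r).coeff 0 := by
  have : (Polynomial.constantCoeff.comp modU : RUV →+* ZMod 2) =
      Polynomial.constantCoeff.comp modV := RUV.hom_ext (by simp) (by simp)
  exact congrArg (fun f => f r) this

theorem RUV.add_self (r : RUV) : r + r = 0 := by
  have h : (2 : RUV) = 0 := by
    have := map_ofNat (algebraMap (ZMod 2) RUV) 2
    rw [← this]
    exact (congrArg _ (show (2 : ZMod 2) = 0 from rfl)).trans (map_zero _)
  rw [← two_mul, h, zero_mul]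

open Polynomial in
/-- The ring homomorphism `𝔽₂[X] → R` sending `X` to `r`. -/
def polyToRUV (r : RUV) : (ZMod 2)[X] →+* RUV :=
  Polynomial.eval₂RingHom (algebraMap (ZMod 2) RUV) r

theorem Uv_dvd_of_modU_eq_zero {r : RUV} (hr : modU r = 0) : Uv ∣ r := by
  have : ((Ideal.Quotient.mk (Ideal.span {Uv})).comp (polyToRUV Vv)).comp modU =
      Ideal.Quotient.mk (Ideal.span {Uv}) := by
    apply RUV.hom_ext
    · simp
    · simp [polyToRUV]
  rw [← Ideal.mem_span_singleton, ← Ideal.Quotient.eq_zero_iff_mem, ← this]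
  simp [hr]

theorem Vv_dvd_of_modV_eq_zero {r : RUV} (hr : modV r = 0) : Vv ∣ r := by
  have : ((Ideal.Quotient.mk (Ideal.span {Vv})).comp (polyToRUV Uv)).comp modV =
      Ideal.Quotient.mk (Ideal.span {Vv}) := by
    apply RUV.hom_ext
    · simp [polyToRUV]
    · simp
  rw [← Ideal.mem_span_singleton, ← Ideal.Quotient.eq_zero_iff_mem, ← this]
  simp [hr]

/-! ### Homogeneity -/

theorem IsHomog.add {r s : RUV} {p q : ℤ} (hr : IsHomog r p q) (hs : IsHomog s p q) :
    IsHomog (r + s) p q := by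
  have key : ∀ {r s : RUV}, r = s → IsHomog (r + s) p q := by
    rintro r s rfl
    exact Or.inl (RUV.add_self r)
  rcases hr with rfl | ⟨a, ra, pa, qa⟩ | ⟨a, ra, pa, qa⟩
  · simpa using hs
  · rcases hs with rfl | ⟨b, rb, pb, qb⟩ | ⟨b, rb, pb, qb⟩
    · exact Or.inr (Or.inl ⟨a, by simp [ra], pa, qa⟩)
    · obtain rfl : a = b := by omega
      exact key (ra.trans rb.symm)
    · obtain rfl : a = 0 := by omega
      obtain rfl : b = 0 := by omega
      exact key (by simp [ra, rb])
  · rcases hs with rfl | ⟨b, rb, pb, qb⟩ | ⟨b, rb, pb, qb⟩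
    · exact Or.inr (Or.inr ⟨a, by simp [ra], pa, qa⟩)
    · obtain rfl : a = 0 := by omega
      obtain rfl : b = 0 := by omega
      exact key (by simp [ra, rb])
    · obtain rfl : a = b := by omega
      exact key (ra.trans rb.symm)

theorem Uv_pow_mul_Vv_pow {a b : ℕ} (ha : a ≠ 0) (hb : b ≠ 0) : Uv ^ a * Vv ^ b = 0 := by
  obtain ⟨a, rfl⟩ := Nat.exists_eq_succ_of_ne_zero ha
  obtain ⟨b, rfl⟩ := Nat.exists_eq_succ_of_ne_zero hb
  rw [pow_succ, pow_succ', mul_assoc, ← mul_assoc Uv, Uv_mul_Vv, zero_mul, mul_zero]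

theorem IsHomog.mul {r s : RUV} {p q p' q' : ℤ} (hr : IsHomog r p q) (hs : IsHomog s p' q') :
    IsHomog (r * s) (p + p') (q + q') := by
  have mixed : ∀ (a b : ℕ) {x y : ℤ}, x = -(2 * (a : ℤ)) → y = -(2 * (b : ℤ)) →
      IsHomog (Uv ^ a * Vv ^ b) x y := by
    intro a b x y hx hy
    rcases eq_or_ne a 0 with rfl | ha
    · exact Or.inr (Or.inr ⟨b, by simp, by simpa using hx, hy⟩)
    rcases eq_or_ne b 0 with rfl | hb
    · exact Or.inr (Or.inl ⟨a, by simp, hx, by simpa using hy⟩)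
    exact Or.inl (Uv_pow_mul_Vv_pow ha hb)
  rcases hr with rfl | ⟨a, rfl, pa, qa⟩ | ⟨a, rfl, pa, qa⟩
  · exact Or.inl (zero_mul _)
  · rcases hs with rfl | ⟨b, rfl, pb, qb⟩ | ⟨b, rfl, pb, qb⟩
    · exact Or.inl (mul_zero _)
    · exact Or.inr (Or.inl ⟨a + b, (pow_add _ _ _).symm, by push_cast; omega, by omega⟩)
    · exact mixed a b (by omega) (by omega)
  · rcases hs with rfl | ⟨b, rfl, pb, qb⟩ | ⟨b, rfl, pb, qb⟩
    · exact Or.inl (mul_zero _)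
    · rw [mul_comm]
      exact mixed b a (by omega) (by omega)
    · exact Or.inr (Or.inr ⟨a + b, (pow_add _ _ _).symm, by omega, by push_cast; omega⟩)

theorem IsHomog.sum {ι : Type*} (s : Finset ι) {f : ι → RUV} {p q : ℤ}
    (hf : ∀ i ∈ s, IsHomog (f i) p q) : IsHomog (∑ i ∈ s, f i) p q :=
  Finset.sum_induction f (fun r => IsHomog r p q) (fun _ _ => IsHomog.add) (Or.inl rfl) hf

/-- A homogeneous element of `R` with nonzero constant term is `1`. -/
theorem IsHomog.eq_one {r : RUV} {p q : ℤ} (hr : IsHomog r p q)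
    (h0 : (modV r).coeff 0 ≠ 0) : r = 1 ∧ p = 0 := by
  rcases hr with rfl | ⟨a, rfl, pa, qa⟩ | ⟨a, rfl, pa, qa⟩
  · simp at h0
  · obtain rfl : a = 0 := by
      by_contra ha
      simp [Polynomial.coeff_X_pow, Ne.symm ha] at h0
    simpa using pa
  · obtain rfl : a = 0 := by
      by_contra ha
      simp [ha] at h0
    simpa using pa

/-! ### Chain maps and the subcomplexes `U·C`, `V·C` -/

theorem dmap_apply (C : PreCx) (x : Msub C) (j : Fin C.n) :
    dmap C x j = ∑ i, x i * C.dm i j := by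
  rw [dmap, Finsupp.linearCombination_apply, Finsupp.sum_fintype _ _ (by simp)]
  simp [Finsupp.finsetSum_apply, Finsupp.single_apply]

theorem dmap_single_apply (C : PreCx) (i j : Fin C.n) :
    dmap C (Finsupp.single i 1) j = C.dm i j := by
  simp [dmap_apply, Finsupp.single_apply]

theorem map_apply_eq_sum {C₁ C₂ : PreCx} (f : Msub C₁ →ₗ[RUV] Msub C₂) (x : Msub C₁)
    (j : Fin C₂.n) : f x j = ∑ i, x i * f (Finsupp.single i 1) j := by
  conv_lhs => rw [← Finsupp.univ_sum_single x]
  rw [map_sum, Finsupp.finsetSum_apply]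
  refine Finset.sum_congr rfl fun i _ => ?_
  rw [← mul_one (x i), ← smul_eq_mul, ← Finsupp.smul_single, map_smul]
  simp

theorem ChainHomog.map {C₁ C₂ : PreCx} {f : Msub C₁ →ₗ[RUV] Msub C₂} {s t : ℤ}
    (hf : MapHomogShift C₁ C₂ f s t) {x : Msub C₁} {p q : ℤ} (hx : ChainHomog C₁ x p q) :
    ChainHomog C₂ (f x) (p + s) (q + t) := by
  intro j
  rw [map_apply_eq_sum]
  refine IsHomog.sum _ fun i _ => ?_
  convert (hx i).mul (hf i j) using 1 <;> ring

theorem chainHomog_single (C : PreCx) (i : Fin C.n) :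
    ChainHomog C (Finsupp.single i 1) (C.gr i).1 (C.gr i).2 := by
  intro j
  rcases eq_or_ne i j with rfl | hij
  · exact Or.inr (Or.inl ⟨0, by simp⟩)
  · exact Or.inl (by simp [hij])

theorem mem_uSub_of_modU {C : PreCx} {x : Msub C} (hx : ∀ j, modU (x j) = 0) :
    x ∈ uSub C := by
  choose y hy using fun j => Uv_dvd_of_modU_eq_zero (hx j)
  exact ⟨Finsupp.equivFunOnFinite.symm y, by ext1 j; simp [hy]⟩

theorem mem_vSub_of_modV {C : PreCx} {x : Msub C} (hx : ∀ j, modV (x j) = 0) :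
    x ∈ vSub C := by
  choose y hy using fun j => Vv_dvd_of_modV_eq_zero (hx j)
  exact ⟨Finsupp.equivFunOnFinite.symm y, by ext1 j; simp [hy]⟩

theorem modU_eq_zero_of_mem_uSub {C : PreCx} {x : Msub C} (hx : x ∈ uSub C) (j : Fin C.n) :
    modU (x j) = 0 := by
  obtain ⟨y, rfl⟩ := hx
  simp

theorem modV_eq_zero_of_mem_vSub {C : PreCx} {x : Msub C} (hx : x ∈ vSub C) (j : Fin C.n) :
    modV (x j) = 0 := by
  obtain ⟨y, rfl⟩ := hx
  simp

theorem modU_eq_zero_of_mem_bdryU {C : PreCx} {j : Fin C.n} (hj : ∀ i, modU (C.dm i j) = 0)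
    {x : Msub C} (hx : x ∈ bdryU C) : modU (x j) = 0 := by
  obtain ⟨y, hy, _, ⟨z, rfl⟩, rfl⟩ := Submodule.mem_sup.1 hx
  simp [modU_eq_zero_of_mem_uSub hy, dmap_apply, hj]

theorem modV_eq_zero_of_mem_bdryV {C : PreCx} {j : Fin C.n} (hj : ∀ i, modV (C.dm i j) = 0)
    {x : Msub C} (hx : x ∈ bdryV C) : modV (x j) = 0 := by
  obtain ⟨y, hy, _, ⟨z, rfl⟩, rfl⟩ := Submodule.mem_sup.1 hx
  simp [modV_eq_zero_of_mem_vSub hy, dmap_apply, hj]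

theorem map_mem_vSub {C₁ C₂ : PreCx} (f : Msub C₁ →ₗ[RUV] Msub C₂) {x : Msub C₁}
    (hx : x ∈ vSub C₁) : f x ∈ vSub C₂ := by
  obtain ⟨y, rfl⟩ := hx
  exact ⟨f y, by simp⟩

theorem map_mem_bdryV {C₁ C₂ : PreCx} {f : Msub C₁ →ₗ[RUV] Msub C₂}
    (hf : ∀ x, f (dmap C₁ x) = dmap C₂ (f x)) {x : Msub C₁}
    (hx : x ∈ bdryV C₁) : f x ∈ bdryV C₂ := by
  obtain ⟨y, hy, _, ⟨z, rfl⟩, rfl⟩ := Submodule.mem_sup.1 hx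
  rw [map_add, hf]
  exact Submodule.add_mem_sup (map_mem_vSub f hy) ⟨f z, rfl⟩

/-! ### Isolated arrows -/

/-- After applying `φ`, the differential of `C` contains the arrow `x_a ↦ X ^ e x_b`, and no
other arrow leaves `x_a` or ends at `x_b`. -/
def IsIsolatedArrow (C : PreCx) (φ : RUV →+* Polynomial (ZMod 2)) (e : ℕ) (a b : Fin C.n) :
    Prop :=
  (∀ j, φ (C.dm a j) = if j = b then Polynomial.X ^ e else 0) ∧
    ∀ i, φ (C.dm i b) = if i = a then Polynomial.X ^ e else 0

/-- The diagonal coefficients of a chain map agree at both ends of an isolated arrow. -/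
theorem IsIsolatedArrow.diagonal_eq {C : PreCx} {φ : RUV →+* Polynomial (ZMod 2)} {e : ℕ}
    {a b : Fin C.n} (hab : IsIsolatedArrow C φ e a b) {f : Msub C →ₗ[RUV] Msub C}
    (hf : ∀ x, f (dmap C x) = dmap C (f x)) :
    φ (f (Finsupp.single a 1) a) = φ (f (Finsupp.single b 1) b) := by
  have h := congrArg (fun y : Msub C => φ (y b)) (hf (Finsupp.single a 1))
  simp only [map_apply_eq_sum f (dmap C _), dmap_apply C (f _), dmap_single_apply, map_sum,
    map_mul, hab.1, hab.2, ite_mul, mul_ite, zero_mul, mul_zero, Finset.sum_ite_eq',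
    Finset.mem_univ, if_true] at h
  rw [mul_comm] at h
  exact (mul_right_cancel₀ (pow_ne_zero _ Polynomial.X_ne_zero) h).symm

/-- Both ends of an isolated arrow modulo `U` contribute `V`-torsion to the homology of `C/U`. -/
theorem IsIsolatedArrow.torsion {C : PreCx} {e : ℕ} {a b : Fin C.n}
    (hab : IsIsolatedArrow C modU e a b) {z : Msub C} (hz : dmap C z ∈ uSub C) {j : Fin C.n}
    (hj : j = a ∨ j = b) : ∃ k : ℕ, Vv ^ k • Finsupp.single j (z j) ∈ bdryU C := by
  rcases hj with rfl | rfl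
  · refine ⟨0, Submodule.mem_sup_left (mem_uSub_of_modU fun i => ?_)⟩
    have h := modU_eq_zero_of_mem_uSub hz b
    simp only [dmap_apply, map_sum, map_mul, hab.2, mul_ite, mul_zero, Finset.sum_ite_eq',
      Finset.mem_univ, if_true] at h
    have hzj := (mul_eq_zero.1 h).resolve_right (pow_ne_zero _ Polynomial.X_ne_zero)
    rcases eq_or_ne j i with rfl | hij
    · simpa using hzj
    · simp [hij]
  · refine ⟨e, ?_⟩
    have h : Vv ^ e • Finsupp.single j 1 - dmap C (Finsupp.single a 1) ∈ uSub C := by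
      refine mem_uSub_of_modU fun i => ?_
      rw [Finsupp.sub_apply, dmap_single_apply, map_sub, hab.1]
      rcases eq_or_ne i j with rfl | hij
      · simp
      · simp [hij]
    have h' : Vv ^ e • Finsupp.single j (1 : RUV) ∈ bdryU C :=
      Submodule.mem_sup.2 ⟨_, h, _, ⟨_, rfl⟩, sub_add_cancel _ _⟩
    have := (bdryU C).smul_mem (z j) h'
    rwa [smul_comm, Finsupp.smul_single_one] at this

/-- A basis element which is isolated modulo `U` generates the `V`-tower when all other basis
elements contribute `V`-torsion. -/
theorem isVTowerGen_single {C : PreCx} {i₀ : Fin C.n} (hleft : ∀ j, modU (C.dm i₀ j) = 0)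
    (hright : ∀ i, modU (C.dm i i₀) = 0)
    (htors : ∀ j, j ≠ i₀ → ∀ z, dmap C z ∈ uSub C →
      ∃ k : ℕ, Vv ^ k • Finsupp.single j (z j) ∈ bdryU C) :
    IsVTowerGen C (Finsupp.single i₀ 1) := by
  refine ⟨mem_uSub_of_modU fun j => ?_, fun k hk => ?_, fun z hz => ?_⟩
  · rw [dmap_single_apply, hleft]
  · have h := modU_eq_zero_of_mem_bdryU hright hk
    simp at h
  · have htors' : ∀ j, ∃ k : ℕ, j ≠ i₀ → Vv ^ k • Finsupp.single j (z j) ∈ bdryU C := by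
      intro j
      by_cases hj : j = i₀
      · exact ⟨0, fun h => absurd hj h⟩
      · exact (htors j hj z hz).imp fun _ hk _ => hk
    choose k hk using htors'
    refine ⟨z i₀, ∑ j, k j, ?_⟩
    have hsum : z - z i₀ • Finsupp.single i₀ 1 =
        ∑ j ∈ Finset.univ.erase i₀, Finsupp.single j (z j) := by
      rw [sub_eq_iff_eq_add, Finsupp.smul_single_one,
        Finset.sum_erase_add _ _ (Finset.mem_univ _), Finsupp.univ_sum_single]
    rw [hsum, Finset.smul_sum]
    refine Submodule.sum_mem _ fun j hj => ?_
    rw [← Finset.add_sum_erase _ _ (Finset.mem_univ j), add_comm, pow_add, mul_smul]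
    exact Submodule.smul_mem _ _ (hk j (Finset.ne_of_mem_erase hj))

/-! ### Standard complexes -/

/-- The reduction of `R` in which the arrow of the `k`-th parameter of a standard complex
survives: modulo `V` for `k` even and modulo `U` for `k` odd. -/
def stepMod (k : ℕ) : RUV →+* Polynomial (ZMod 2) := if k % 2 = 0 then modV else modU

theorem stepMod_stdDm (L : List ℤ) (k : ℕ) (i j : Fin (L.length + 1)) :
    stepMod k (stdDm L i j) =
      if (j : ℕ) = i + 1 ∧ L.getD i 0 < 0 ∧ (i : ℕ) % 2 = k % 2 then
        Polynomial.X ^ (L.getD i 0).natAbs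
      else if (i : ℕ) = j + 1 ∧ 0 < L.getD j 0 ∧ (j : ℕ) % 2 = k % 2 then
        Polynomial.X ^ (L.getD j 0).natAbs
      else 0 := by
  have key : ∀ m b, b ≠ 0 → stepMod k ((if m % 2 = 0 then Uv else Vv) ^ (Int.natAbs b)) =
      if m % 2 = k % 2 then Polynomial.X ^ b.natAbs else 0 := by
    intro m b hb
    have hb' : b.natAbs ≠ 0 := by simpa using hb
    rcases Nat.mod_two_eq_zero_or_one m with hm | hm <;>
      rcases Nat.mod_two_eq_zero_or_one k with hk | hk <;>
      simp [stepMod, hm, hk, hb']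
  unfold stdDm
  by_cases h1 : (j : ℕ) = i + 1 ∧ L.getD i 0 < 0
  · have h2 : ¬((i : ℕ) = j + 1 ∧ 0 < L.getD j 0 ∧ (j : ℕ) % 2 = k % 2) := by omega
    rw [if_pos h1, key _ _ h1.2.ne, if_neg h2]
    simp only [h1, true_and]
  · have h1' : ¬((j : ℕ) = i + 1 ∧ L.getD i 0 < 0 ∧ (i : ℕ) % 2 = k % 2) :=
      fun h => h1 ⟨h.1, h.2.1⟩
    rw [if_neg h1, if_neg h1']
    by_cases h2 : (i : ℕ) = j + 1 ∧ 0 < L.getD j 0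
    · rw [if_pos h2, key _ _ h2.2.ne']
      simp only [h2, true_and]
    · rw [if_neg h2, if_neg (fun h => h2 ⟨h.1, h.2.1⟩), map_zero]

theorem exists_isIsolatedArrow {L : List ℤ} (hL : IsStdSeq L) {k : ℕ} (hk : k < L.length) :
    ∃ (e : ℕ) (a b : Fin (StdCx L).n), IsIsolatedArrow (StdCx L) (stepMod k) e a b ∧
      (((a : ℕ) = k ∧ (b : ℕ) = k + 1) ∨ ((a : ℕ) = k + 1 ∧ (b : ℕ) = k)) := by
  have hb : L.getD k 0 ≠ 0 := by
    rw [List.getD_eq_getElem _ _ hk]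
    exact hL.1 _ (List.getElem_mem hk)
  rcases lt_or_gt_of_ne hb with hb | hb
  · refine ⟨(L.getD k 0).natAbs, ⟨k, Nat.lt_succ_of_lt hk⟩, ⟨k + 1, Nat.succ_lt_succ hk⟩,
      ⟨fun j => ?_, fun i => ?_⟩, Or.inl ⟨rfl, rfl⟩⟩ <;>
    refine (stepMod_stdDm L k _ _).trans ?_ <;>
    simp only [Fin.ext_iff] <;>
    grind
  · refine ⟨(L.getD k 0).natAbs, ⟨k + 1, Nat.succ_lt_succ hk⟩, ⟨k, Nat.lt_succ_of_lt hk⟩,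
      ⟨fun j => ?_, fun i => ?_⟩, Or.inr ⟨rfl, rfl⟩⟩ <;>
    refine (stepMod_stdDm L k _ _).trans ?_ <;>
    simp only [Fin.ext_iff] <;>
    grind

/-- The index of the first generator `x_0` of a standard complex. -/
def firstGen (L : List ℤ) : Fin (StdCx L).n := (0 : Fin (L.length + 1))

/-- The index of the last generator `x_n` of a standard complex. -/
def lastGen (L : List ℤ) : Fin (StdCx L).n := Fin.last L.length

theorem modU_dm_firstGen_right (L : List ℤ) (i : Fin (StdCx L).n) :
    modU ((StdCx L).dm i (firstGen L)) = 0 := by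
  refine (stepMod_stdDm L 1 i (0 : Fin (L.length + 1))).trans ?_
  simp

theorem modU_dm_firstGen_left (L : List ℤ) (j : Fin (StdCx L).n) :
    modU ((StdCx L).dm (firstGen L) j) = 0 := by
  refine (stepMod_stdDm L 1 (0 : Fin (L.length + 1)) j).trans ?_
  simp

theorem modV_dm_lastGen_right {L : List ℤ} (hL : IsStdSeq L) (i : Fin (StdCx L).n) :
    modV ((StdCx L).dm i (lastGen L)) = 0 := by
  refine (stepMod_stdDm L 0 i (Fin.last L.length)).trans ?_
  have hn := Nat.even_iff.1 hL.2
  have hi : (i : ℕ) < L.length + 1 := i.isLt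
  rw [Fin.val_last, if_neg (by omega), if_neg (by omega)]

theorem modV_dm_lastGen_left {L : List ℤ} (hL : IsStdSeq L) (j : Fin (StdCx L).n) :
    modV ((StdCx L).dm (lastGen L) j) = 0 := by
  refine (stepMod_stdDm L 0 (Fin.last L.length) j).trans ?_
  have hn := Nat.even_iff.1 hL.2
  have hj : (j : ℕ) < L.length + 1 := j.isLt
  rw [Fin.val_last, if_neg (by omega), if_neg (by omega)]

/-- The first generator of a standard complex is a `V`-tower generator. -/
theorem isVTowerGen_firstGen {L : List ℤ} (hL : IsStdSeq L) :
    IsVTowerGen (StdCx L) (Finsupp.single (firstGen L) 1) := by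
  refine isVTowerGen_single (modU_dm_firstGen_left L) (modU_dm_firstGen_right L)
    fun j hj z hz => ?_
  have hj0 : (j : ℕ) ≠ 0 := fun h => hj (Fin.ext h)
  have hjlt : (j : ℕ) < L.length + 1 := j.isLt
  have hn := Nat.even_iff.1 hL.2
  obtain ⟨m, hm, hmlt, hjm⟩ :
      ∃ m, m % 2 = 1 ∧ m < L.length ∧ ((j : ℕ) = m ∨ (j : ℕ) = m + 1) := by
    rcases Nat.mod_two_eq_zero_or_one j with h | h
    · exact ⟨j - 1, by omega, by omega, by omega⟩
    · exact ⟨j, by omega, by omega, by omega⟩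
  obtain ⟨e, a, b, hab, hv⟩ := exists_isIsolatedArrow hL hmlt
  rw [show stepMod m = modU by simp [stepMod, hm]] at hab
  refine hab.torsion hz ?_
  simp only [Fin.ext_iff]
  omega

/-- The diagonal coefficients of a chain map of a standard complex to itself all have the
same constant term. -/
theorem coeff_zero_diagonal_eq {L : List ℤ} (hL : IsStdSeq L)
    {f : Msub (StdCx L) →ₗ[RUV] Msub (StdCx L)}
    (hf : ∀ x, f (dmap (StdCx L) x) = dmap (StdCx L) (f x)) (i : Fin (StdCx L).n) :
    (modV (f (Finsupp.single i 1) i)).coeff 0 =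
      (modV (f (Finsupp.single (firstGen L) 1) (firstGen L))).coeff 0 := by
  have hstep : ∀ k r, (stepMod k r).coeff 0 = (modV r).coeff 0 := by
    intro k r
    unfold stepMod
    split_ifs
    · rfl
    · exact constantCoeff_modU_eq r
  obtain ⟨k, hk⟩ := i
  induction k with
  | zero => rfl
  | succ k ih =>
    rw [← ih (Nat.lt_of_succ_lt hk)]
    obtain ⟨e, a, b, hab, hv⟩ := exists_isIsolatedArrow hL (Nat.lt_of_succ_lt_succ hk)
    have h := congrArg (fun p => Polynomial.coeff p 0) (hab.diagonal_eq hf)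
    simp only [hstep] at h
    rcases hv with ⟨ha, hb⟩ | ⟨ha, hb⟩
    · rw [show a = ⟨k, Nat.lt_of_succ_lt hk⟩ from Fin.ext ha,
        show b = ⟨k + 1, hk⟩ from Fin.ext hb] at h
      exact h.symm
    · rw [show a = ⟨k + 1, hk⟩ from Fin.ext ha,
        show b = ⟨k, Nat.lt_of_succ_lt hk⟩ from Fin.ext hb] at h
      exact h

/-- The constant term of the first coefficient of a `V`-tower generator is nonzero. -/
theorem IsVTowerGen.coeff_zero_ne_zero {L : List ℤ} (hL : IsStdSeq L) {x : Msub (StdCx L)}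
    (hx : IsVTowerGen (StdCx L) x) : (modV (x (firstGen L))).coeff 0 ≠ 0 := by
  obtain ⟨r, k, hrk⟩ := hx.2.2 _ (isVTowerGen_firstGen hL).1
  have h := modU_eq_zero_of_mem_bdryU (modU_dm_firstGen_right L) hrk
  have h1 : 1 - modU r * modU (x (firstGen L)) = 0 := by simpa using h
  intro h0
  rw [← constantCoeff_modU_eq] at h0
  have h2 := congrArg (fun p => Polynomial.coeff p 0) h1
  simp [Polynomial.mul_coeff_zero, h0] at h2

theorem Pval_eq_grRel {L : List ℤ} (hL : IsStdSeq L) : Pval L = (grRel L L.length).1 := by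
  have hphi : ∑ j ∈ Finset.range ((L.map Int.natAbs).sum + 1), (j : ℤ) * phi j L =
      ∑ i ∈ Finset.range L.length, if i % 2 = 0 then L.getD i 0 else 0 := by
    simp only [phi, Finset.mul_sum]
    rw [Finset.sum_comm]
    refine Finset.sum_congr rfl fun i hi => ?_
    split_ifs with h
    · set b := L.getD i 0 with hb
      have hbS : b.natAbs ∈ Finset.range ((L.map Int.natAbs).sum + 1) := by
        rw [Finset.mem_range, Nat.lt_succ_iff, hb,
          List.getD_eq_getElem _ _ (Finset.mem_range.1 hi)]
        exact List.single_le_sum (by simp) _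
          (List.mem_map_of_mem (List.getElem_mem (Finset.mem_range.1 hi)))
      rw [Finset.sum_eq_single_of_mem _ hbS]
      · split_ifs <;> omega
      · intro j _ hj
        rw [if_neg (by omega), if_neg (by omega)]
        simp
    · simp
  have hsign : (L.map Int.sign).sum = ∑ i ∈ Finset.range L.length, (L.getD i 0).sign := by
    rw [Finset.sum_range, ← List.sum_ofFn]
    congr 1
    apply List.ext_getElem <;> simp +contextual
  rw [Pval, hphi, hsign, grRel, Prod.fst_sum, Finset.mul_sum, ← Finset.sum_add_distrib]
  refine Finset.sum_congr rfl fun i hi => ?_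
  have hb : L.getD i 0 ≠ 0 := by
    rw [List.getD_eq_getElem _ _ (Finset.mem_range.1 hi)]
    exact hL.1 _ (List.getElem_mem _)
  unfold stepShift
  rcases lt_or_gt_of_ne hb with hb | hb
  · rw [Int.sign_eq_neg_one_of_neg hb]
    split_ifs <;> simp only <;> omega
  · rw [Int.sign_eq_one_of_pos hb]
    split_ifs <;> simp only <;> omega

/-- If `f : C → C(L)` and `g : C(L) → C` are local maps, then `g` sends the last generator of
`C(L)` to a `U`-tower generator, and `f` sends every `U`-tower generator to a chain whose last
coefficient has nonzero constant term. -/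
theorem isUTowerGen_map_lastGen {C : PreCx} (hC : IsKnotLike C) {L : List ℤ} (hL : IsStdSeq L)
    {f : Msub C →ₗ[RUV] Msub (StdCx L)} {g : Msub (StdCx L) →ₗ[RUV] Msub C}
    (hf : IsLocalMap C (StdCx L) f) (hg : IsLocalMap (StdCx L) C g) :
    IsUTowerGen C (g (Finsupp.single (lastGen L) 1)) ∧
      ∀ x, IsUTowerGen C x → (modV (f x (lastGen L))).coeff 0 ≠ 0 := by
  set y := g (Finsupp.single (lastGen L) 1) with hy
  have hlast : ∀ {x : Msub C}, x ∈ bdryV C → modV (f x (lastGen L)) = 0 := fun hx =>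
    modV_eq_zero_of_mem_bdryV (modV_dm_lastGen_right hL) (map_mem_bdryV hf.chain hx)
  have hfy : modV (f y (lastGen L)) = 1 := by
    have h0 : (modV (f y (lastGen L))).coeff 0 ≠ 0 := by
      have h := coeff_zero_diagonal_eq hL (f := f ∘ₗ g)
        (fun x => by simp [hf.chain, hg.chain]) (lastGen L)
      simp only [LinearMap.comp_apply] at h
      rw [hy, h]
      exact (hf.towers _ (hg.towers _ (isVTowerGen_firstGen hL))).coeff_zero_ne_zero hL
    obtain ⟨s, hs⟩ := hf.graded
    obtain ⟨t, ht⟩ := hg.graded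
    have := ((chainHomog_single (StdCx L) (lastGen L)).map ht).map hs (lastGen L)
    rw [← hy] at this
    rw [(this.eq_one h0).1, map_one]
  have hycyc : dmap C y ∈ vSub C := by
    rw [hy, ← hg.chain]
    refine map_mem_vSub g (mem_vSub_of_modV fun j => ?_)
    rw [dmap_single_apply, modV_dm_lastGen_left hL]
  have hinv : ∀ {x : Msub C} {r : RUV} {k : ℕ}, Uv ^ k • (y - r • x) ∈ bdryV C →
      modV r * modV (f x (lastGen L)) = 1 := by
    intro x r k h
    have h1 := hlast h
    simp only [map_smul, map_sub, Finsupp.smul_apply, Finsupp.sub_apply, smul_eq_mul, map_mul,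
      map_pow, modV_Uv, hfy] at h1
    exact (sub_eq_zero.1 ((mul_eq_zero.1 h1).resolve_left
      (pow_ne_zero _ Polynomial.X_ne_zero))).symm
  refine ⟨⟨hycyc, fun k hk => ?_, fun z hz => ?_⟩, fun x hx h0 => ?_⟩
  · have h := hlast hk
    simp [hfy] at h
  · obtain ⟨x, hx⟩ := hC.uTowerExists
    obtain ⟨r, k, hk⟩ := hx.2.2 z hz
    obtain ⟨s, l, hl⟩ := hx.2.2 y hycyc
    set d := f x (lastGen L)
    obtain ⟨w, hw⟩ : Vv ∣ s * d - 1 :=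
      Vv_dvd_of_modV_eq_zero (by rw [map_sub, map_mul, hinv hl, map_one, sub_self])
    refine ⟨r * d, k + l, ?_⟩
    have h1 : Uv ^ (k + l) • (z - (r * d) • y) =
        Uv ^ l • (Uv ^ k • (z - r • x)) - (Uv ^ k * r * d) • (Uv ^ l • (y - s • x)) -
          Vv • ((Uv ^ (k + l) * r * w) • x) := by
      have h2 : Vv • ((Uv ^ (k + l) * r * w) • x) =
          (Uv ^ (k + l) * r * (s * d - 1)) • x := by
        rw [hw, smul_smul]
        congr 1
        ring
      rw [h2]
      module
    rw [h1]
    exact Submodule.sub_mem _ (Submodule.sub_mem _ (Submodule.smul_mem _ _ hk)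
      (Submodule.smul_mem _ _ hl)) (Submodule.mem_sup_left ⟨_, rfl⟩)
  · obtain ⟨s, l, hl⟩ := hx.2.2 y hycyc
    have h := congrArg (fun p => Polynomial.coeff p 0) (hinv hl)
    simp [Polynomial.mul_coeff_zero, h0] at h

end

/-- For a knot-like complex `C` with standard complex representative
`C(a_1, …, a_n)`, the integer `P(C) = -2 ∑_{j>0} j φ_j(C) + ∑_{i=1}^n sgn(a_i)` equals
the `U`-grading `gr_U` of a `U`-tower generator of `C`, i.e. of a maximally `U`-graded
`U`-nontorsion cycle in `C/V`. -/
theorem P_equals_grU_of_U_tower_generator (C : PreCx) (hC : IsKnotLike C)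
    (L : List ℤ) (hL : IsStdSeq L) (h : LocalEquiv C (StdCx L)) :
    (∃ (x : Msub C) (q : ℤ), IsUTowerGen C x ∧ ChainHomog C x (Pval L) q) ∧
    (∀ (x : Msub C) (p q : ℤ), IsUTowerGen C x → ChainHomog C x p q → p = Pval L) := by
  obtain ⟨⟨f, hf⟩, g, hg⟩ := h
  obtain ⟨htower, hcoeff⟩ := isUTowerGen_map_lastGen hC hL hf hg
  have hgr : ((StdCx L).gr (lastGen L)).1 = Pval L := (Pval_eq_grRel hL).symm
  refine ⟨?_, fun x p q hx hpq => ?_⟩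
  · obtain ⟨t, ht⟩ := hg.graded
    have h := (chainHomog_single (StdCx L) (lastGen L)).map ht
    rw [hgr, add_zero] at h
    exact ⟨_, _, htower, h⟩
  · obtain ⟨s, hs⟩ := hf.graded
    have h := ((hpq.map hs (lastGen L)).eq_one (hcoeff x hx)).2
    rw [hgr] at h
    linarith
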